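/- Let (Ω, F, P) be a probability space with a filtration (F_t)_{t∈[0,T]}, and let Z : [0,T] × Ω → ℝ^d be progressively measurable with E[∫₀^T |Z_s|² ds] < ∞. For a partition π = {0 = t₀ < ⋯ < t_N = T} with mesh |π| = max_i (t_{i+1} − t_i), define Z̄^π_t = (1/(t_{i+1} − t_i)) · E[∫_{t_i}^{t_{i+1}} Z_s ds | F_{t_i}] for t ∈ [t_i, t_{i+1}). Then E[∫₀^T |Z_s − Z̄^π_s|² ds] → 0 as |π| → 0. -/

import Mathlib

open MeasureTheory Set
open scoped ENNReal NNReal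


lemma lint_sq {X : Type*} [MeasurableSpace X] (μ : Measure X) {f : X → ℝ≥0∞}
    (hf : AEMeasurable f μ) : (∫⁻ x, f x ∂μ) ^ 2 ≤ μ univ * ∫⁻ x, f x ^ 2 ∂μ := by
  have h := ENNReal.lintegral_mul_le_Lp_mul_Lq μ Real.HolderConjugate.two_two hf
    (aemeasurable_const (b := (1 : ℝ≥0∞)))
  simp only [Pi.mul_apply, mul_one, ENNReal.one_rpow, lintegral_const, one_mul] at h
  calc (∫⁻ x, f x ∂μ) ^ 2 ≤ ((∫⁻ x, f x ^ (2:ℝ) ∂μ) ^ (1 / 2 : ℝ) * μ univ ^ (1 / 2 : ℝ)) ^ 2 := by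
        gcongr
    _ = _ := by
        rw [mul_pow, mul_comm, ← ENNReal.rpow_natCast, ← ENNReal.rpow_mul,
          ← ENNReal.rpow_natCast (_ ^ _), ← ENNReal.rpow_mul]
        norm_num

lemma avg_bound {E : Type*} [NormedAddCommGroup E] [NormedSpace ℝ E] [CompleteSpace E]
    {S : Set ℝ} {c : ℝ} (hc : 0 < c) (hS : volume S = ENNReal.ofReal c) {f : ℝ → E}
    (hf : IntegrableOn f S) (x : E) :
    ‖x - c⁻¹ • ∫ v in S, f v‖ₑ ^ 2 ≤ ENNReal.ofReal c⁻¹ * ∫⁻ v in S, ‖x - f v‖ₑ ^ 2 := by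
  have hS' : volume S ≠ ⊤ := by rw [hS]; exact ENNReal.ofReal_ne_top
  have h1 : x - c⁻¹ • ∫ v in S, f v = c⁻¹ • ∫ v in S, (x - f v) := by
    have hcst : IntegrableOn (fun _ : ℝ => x) S := integrableOn_const (hs := hS')
    rw [integral_sub hcst hf, setIntegral_const, smul_sub, measureReal_def, hS,
      ENNReal.toReal_ofReal hc.le, smul_smul, inv_mul_cancel₀ hc.ne', one_smul]
  rw [h1, enorm_smul, mul_pow, Real.enorm_eq_ofReal (inv_nonneg.2 hc.le)]
  have h2 : ‖∫ v in S, (x - f v)‖ₑ ^ 2 ≤ ENNReal.ofReal c * ∫⁻ v in S, ‖x - f v‖ₑ ^ 2 := by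
    calc _ ≤ (∫⁻ v in S, ‖x - f v‖ₑ) ^ 2 := by
          gcongr; exact enorm_integral_le_lintegral_enorm _
      _ ≤ _ := by
          have := lint_sq (volume.restrict S) (f := fun v => ‖x - f v‖ₑ)
            ((aestronglyMeasurable_const.sub hf.aestronglyMeasurable).enorm)
          rwa [Measure.restrict_apply_univ, hS] at this
  calc _ ≤ ENNReal.ofReal c⁻¹ ^ 2 * (ENNReal.ofReal c * ∫⁻ v in S, ‖x - f v‖ₑ ^ 2) := by gcongr
    _ = ENNReal.ofReal c⁻¹ * (ENNReal.ofReal c⁻¹ * ENNReal.ofReal c) * ∫⁻ v in S, ‖x - f v‖ₑ ^ 2 := by ring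
    _ = _ := by
      rw [← ENNReal.ofReal_mul (inv_nonneg.2 hc.le), inv_mul_cancel₀ hc.ne']; simp

lemma eLp2 {X E : Type*} [NormedAddCommGroup E] [MeasurableSpace X] (μ : Measure X) (f : X → E) :
    eLpNorm f 2 μ ^ 2 = ∫⁻ x, ‖f x‖ₑ ^ 2 ∂μ := by
  rw [eLpNorm_eq_lintegral_rpow_enorm_toReal (by simp) (by simp), ← ENNReal.rpow_natCast,
    ← ENNReal.rpow_mul]
  norm_num

lemma memLp2 {X E : Type*} [NormedAddCommGroup E] [MeasurableSpace X] {μ : Measure X} {f : X → E}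
    (hf : AEStronglyMeasurable f μ) (h : ∫⁻ x, ‖f x‖ₑ ^ 2 ∂μ < ⊤) : MemLp f 2 μ := by
  refine ⟨hf, ?_⟩
  rw [← eLp2] at h
  by_contra h'
  simp only [not_lt, top_le_iff] at h'
  simp [h'] at h

lemma transl {E : Type*} [NormedAddCommGroup E] {f : ℝ → E}
    (hf : MemLp f 2 (volume : Measure ℝ)) :
    Filter.Tendsto (fun u : ℝ => ∫⁻ s, ‖f s - f (s - u)‖ₑ ^ 2) (nhds 0) (nhds 0) := by
  have : Fact ((2:ℝ≥0∞) ≠ ∞) := ⟨by simp⟩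
  have hc : Continuous fun u : ℝ => (DomAddAct.mk (-u)) +ᵥ hf.toLp f := by
    have h1 : Continuous fun u : ℝ => DomAddAct.mk (-u) :=
      (DomAddAct.continuous_mk).comp continuous_neg
    exact h1.vadd continuous_const
  have h2 := (continuous_const (y := hf.toLp f)).edist hc |>.tendsto 0
  simp only [neg_zero] at h2
  have h3 := ((ENNReal.continuous_pow 2).tendsto _).comp h2
  have h0 : (DomAddAct.mk (0:ℝ)) +ᵥ hf.toLp f = hf.toLp f := by simp
  rw [h0, edist_self] at h3
  simp only [ne_eq, OfNat.ofNat_ne_zero, not_false_eq_true, zero_pow] at h3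
  refine h3.congr fun u => ?_
  simp only [Function.comp]
  rw [DomAddAct.mk_vadd_toLp, Lp.edist_toLp_toLp, eLp2]
  refine lintegral_congr fun s => ?_
  simp [sub_eq_neg_add, vadd_eq_add]

lemma enorm_sub_sq {E : Type*} [NormedAddCommGroup E] (x y : E) :
    ‖x - y‖ₑ ^ 2 ≤ 2 * ‖x‖ₑ ^ 2 + 2 * ‖y‖ₑ ^ 2 := by
  have h : ‖x - y‖ ^ 2 ≤ 2 * ‖x‖ ^ 2 + 2 * ‖y‖ ^ 2 := by
    have := norm_sub_le x y
    nlinarith [sq_nonneg (‖x‖ - ‖y‖), norm_nonneg (x - y), norm_nonneg x, norm_nonneg y]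
  have h' := ENNReal.ofReal_le_ofReal h
  rw [ENNReal.ofReal_add (by positivity) (by positivity), ENNReal.ofReal_mul (by norm_num),
    ENNReal.ofReal_mul (by norm_num), ENNReal.ofReal_pow (norm_nonneg _),
    ENNReal.ofReal_pow (norm_nonneg _), ENNReal.ofReal_pow (norm_nonneg _)] at h'
  simpa only [ofReal_norm, ENNReal.ofReal_ofNat] using h'

lemma transl_avg {Ω : Type*} {m0 : MeasurableSpace Ω} {P : Measure Ω}
    {E : Type*} [NormedAddCommGroup E] {W : ℝ → Ω → E}
    (hW : StronglyMeasurable (Function.uncurry W))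
    (hW2 : ∫⁻ ω, ∫⁻ s, ‖W s ω‖ₑ ^ 2 ∂volume ∂P < ⊤) :
    Filter.Tendsto (fun u : ℝ => ∫⁻ ω, ∫⁻ s, ‖W s ω - W (s - u) ω‖ₑ ^ 2 ∂volume ∂P) (nhds 0) (nhds 0) := by
  have hm : ∀ u : ℝ, Measurable fun ω => ∫⁻ s, ‖W s ω - W (s - u) ω‖ₑ ^ 2 := by
    intro u
    refine Measurable.lintegral_prod_left'
      (f := fun p : ℝ × Ω => ‖W p.1 p.2 - W (p.1 - u) p.2‖ₑ ^ 2) ?_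
    refine Measurable.pow_const (StronglyMeasurable.enorm ?_) 2
    exact hW.sub (hW.comp_measurable
      (g := fun p : ℝ × Ω => (p.1 - u, p.2)) (by fun_prop))
  have hm' : Measurable fun ω => ∫⁻ s, ‖W s ω‖ₑ ^ 2 :=
    Measurable.lintegral_prod_left' (f := fun p : ℝ × Ω => ‖W p.1 p.2‖ₑ ^ 2)
      (Measurable.pow_const hW.enorm 2)
  have hsec : ∀ ω, StronglyMeasurable fun s => W s ω := fun ω =>
    hW.comp_measurable (g := fun s : ℝ => (s, ω)) (by fun_prop)
  have := tendsto_lintegral_filter_of_dominated_convergence (μ := P) (l := nhds (0:ℝ))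
    (F := fun u ω => ∫⁻ s, ‖W s ω - W (s - u) ω‖ₑ ^ 2) (f := fun _ => 0)
    (fun ω => 4 * ∫⁻ s, ‖W s ω‖ₑ ^ 2) (Filter.Eventually.of_forall hm) ?_ ?_ ?_
  · simpa using this
  · refine Filter.Eventually.of_forall fun u => Filter.Eventually.of_forall fun ω => ?_
    calc ∫⁻ s, ‖W s ω - W (s - u) ω‖ₑ ^ 2
        ≤ ∫⁻ s, (2 * ‖W s ω‖ₑ ^ 2 + 2 * ‖W (s - u) ω‖ₑ ^ 2) :=
          lintegral_mono fun s => enorm_sub_sq _ _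
      _ = 2 * (∫⁻ s, ‖W s ω‖ₑ ^ 2) + 2 * ∫⁻ s, ‖W (s - u) ω‖ₑ ^ 2 := by
          rw [lintegral_add_left (((hsec ω).enorm.pow_const 2).const_mul 2),
            lintegral_const_mul' _ _ (by simp), lintegral_const_mul' _ _ (by simp)]
      _ = 4 * ∫⁻ s, ‖W s ω‖ₑ ^ 2 := by
          rw [lintegral_sub_right_eq_self (fun s => ‖W s ω‖ₑ ^ 2) u, ← add_mul]; norm_num
  · rw [lintegral_const_mul' _ _ (by simp)]
    exact ENNReal.mul_ne_top (by simp) hW2.ne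
  · filter_upwards [ae_lt_top hm' hW2.ne] with ω hω
    exact transl (memLp2 (hsec ω).aestronglyMeasurable hω)

lemma avg_key {Ω : Type*} {m0 : MeasurableSpace Ω} {P : Measure Ω}
    {E : Type*} [NormedAddCommGroup E] [NormedSpace ℝ E] [CompleteSpace E] {W : ℝ → Ω → E}
    (hW : StronglyMeasurable (Function.uncurry W))
    (hW2 : ∫⁻ ω, ∫⁻ s, ‖W s ω‖ₑ ^ 2 ∂volume ∂P < ⊤) {a b : ℝ} (hab : a < b) :
    ∀ᵐ ω ∂P, ∀ x : E, ‖x - (b - a)⁻¹ • ∫ u in Icc a b, W u ω‖ₑ ^ 2 ≤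
      ENNReal.ofReal (b - a)⁻¹ * ∫⁻ v in Icc a b, ‖x - W v ω‖ₑ ^ 2 := by
  have hsec : ∀ ω, StronglyMeasurable fun s => W s ω := fun ω =>
    hW.comp_measurable (g := fun s : ℝ => (s, ω)) (by fun_prop)
  have hm' : Measurable fun ω => ∫⁻ s, ‖W s ω‖ₑ ^ 2 :=
    Measurable.lintegral_prod_left' (f := fun p : ℝ × Ω => ‖W p.1 p.2‖ₑ ^ 2)
      (Measurable.pow_const hW.enorm 2)
  filter_upwards [ae_lt_top hm' hW2.ne] with ω hω x
  have : MemLp (fun s => W s ω) 2 volume := memLp2 (hsec ω).aestronglyMeasurable hω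
  exact avg_bound (sub_pos.2 hab) (by simp) ((this.restrict (Icc a b)).integrable (by norm_num)) x

lemma avg_memLp {Ω : Type*} {m0 : MeasurableSpace Ω} {P : Measure Ω}
    {E : Type*} [NormedAddCommGroup E] [NormedSpace ℝ E] [CompleteSpace E] {W : ℝ → Ω → E}
    (hW : StronglyMeasurable (Function.uncurry W))
    (hW2 : ∫⁻ ω, ∫⁻ s, ‖W s ω‖ₑ ^ 2 ∂volume ∂P < ⊤) {a b : ℝ} (hab : a < b) :
    MemLp (fun ω => (b - a)⁻¹ • ∫ u in Icc a b, W u ω) 2 P := by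
  have hAm : StronglyMeasurable (fun ω => (b - a)⁻¹ • ∫ u in Icc a b, W u ω) :=
    (StronglyMeasurable.integral_prod_left hW).const_smul _
  refine memLp2 hAm.aestronglyMeasurable ?_
  calc _ ≤ ∫⁻ ω, ENNReal.ofReal (b - a)⁻¹ * ∫⁻ v, ‖W v ω‖ₑ ^ 2 ∂volume ∂P := by
        refine lintegral_mono_ae ?_
        filter_upwards [avg_key hW hW2 hab] with ω hω
        have := hω 0
        simp only [zero_sub, enorm_neg] at this
        refine this.trans ?_
        gcongr
        exact Measure.restrict_le_self
    _ = ENNReal.ofReal (b - a)⁻¹ * ∫⁻ ω, ∫⁻ v, ‖W v ω‖ₑ ^ 2 ∂volume ∂P :=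
        lintegral_const_mul' _ _ ENNReal.ofReal_ne_top
    _ < ⊤ := ENNReal.mul_lt_top ENNReal.ofReal_lt_top hW2

lemma approx {Ω : Type*} {m m0 : MeasurableSpace Ω} (hmm : m ≤ m0) {P : Measure Ω}
    [IsProbabilityMeasure P]
    {E : Type*} [NormedAddCommGroup E] [NormedSpace ℝ E] [CompleteSpace E] {W : ℝ → Ω → E}
    (hW : StronglyMeasurable (Function.uncurry W))
    (hW2 : ∫⁻ ω, ∫⁻ s, ‖W s ω‖ₑ ^ 2 ∂volume ∂P < ⊤) {a b : ℝ} (hab : a < b) {ξ : Ω → E}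
    (hξ : StronglyMeasurable[m] ξ) (hξ2 : MemLp ξ 2 P) :
    ∫⁻ ω, ∫⁻ s in Ico a b, ‖W s ω - (b - a)⁻¹ •
        (P[(fun ω' => ∫ u in Icc a b, W u ω') | m]) ω‖ₑ ^ 2 ∂volume ∂P ≤
      4 * ∫⁻ ω, ∫⁻ s in Ico a b, ‖W s ω - ξ ω‖ₑ ^ 2 ∂volume ∂P := by
  have hc : 0 < b - a := sub_pos.2 hab
  set I : Ω → E := fun ω' => ∫ u in Icc a b, W u ω' with hI
  set A : Ω → E := (b - a)⁻¹ • I with hA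
  have key : ∀ x : Ω → E, ∀ᵐ ω ∂P, ‖x ω - A ω‖ₑ ^ 2 ≤
      ENNReal.ofReal (b - a)⁻¹ * ∫⁻ v in Ico a b, ‖W v ω - x ω‖ₑ ^ 2 := by
    intro x
    filter_upwards [avg_key hW hW2 hab] with ω hω
    have := hω (x ω)
    rw [← setLIntegral_congr (Ico_ae_eq_Icc (a := a) (b := b))] at this
    simp only [enorm_sub_rev (x ω) (W _ ω)] at this
    exact this
  have hA2 : MemLp A 2 P := avg_memLp hW hW2 hab
  have hce : ∀ᵐ ω ∂P, (P[A - ξ | m]) ω = (b - a)⁻¹ • (P[I | m]) ω - ξ ω := by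
    filter_upwards [condExp_sub (hA2.integrable (by norm_num)) (hξ2.integrable (by norm_num)) m,
      condExp_smul (μ := P) (b - a)⁻¹ I m] with ω h1 h2
    rw [h1, Pi.sub_apply, condExp_of_stronglyMeasurable hmm hξ (hξ2.integrable (by norm_num)),
      hA, h2, Pi.smul_apply]
  have hD : ∫⁻ ω, ‖(P[A - ξ | m]) ω‖ₑ ^ 2 ∂P ≤ ∫⁻ ω, ‖A ω - ξ ω‖ₑ ^ 2 ∂P := by
    have := eLpNorm_condExp_le_eLpNorm (m := m) (μ := P) (A - ξ) (p := 2) (by norm_num)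
    rw [← eLp2, ← eLp2 P (fun ω => A ω - ξ ω)]
    gcongr
    exact this
  have hmξ : Measurable fun ω => ∫⁻ s in Ico a b, ‖W s ω - ξ ω‖ₑ ^ 2 := by
    refine Measurable.lintegral_prod_left'
      (f := fun p : ℝ × Ω => ‖W p.1 p.2 - ξ p.2‖ₑ ^ 2) ?_
    refine Measurable.pow_const (StronglyMeasurable.enorm ?_) 2
    exact hW.sub ((hξ.mono hmm).comp_measurable measurable_snd)
  set J := ∫⁻ ω, ∫⁻ s in Ico a b, ‖W s ω - ξ ω‖ₑ ^ 2 ∂volume ∂P with hJ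
  calc _ ≤ ∫⁻ ω, (2 * (∫⁻ s in Ico a b, ‖W s ω - ξ ω‖ₑ ^ 2) +
        2 * (ENNReal.ofReal (b - a) * ‖(P[A - ξ | m]) ω‖ₑ ^ 2)) ∂P := by
        refine lintegral_mono_ae ?_
        filter_upwards [hce] with ω hω
        calc _ ≤ ∫⁻ s in Ico a b, (2 * ‖W s ω - ξ ω‖ₑ ^ 2 + 2 * ‖(P[A - ξ | m]) ω‖ₑ ^ 2) := by
              refine lintegral_mono fun s => ?_
              have := enorm_sub_sq (W s ω - ξ ω) ((P[A - ξ | m]) ω)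
              rw [hω] at this ⊢
              simpa using this
          _ = _ := by
              rw [lintegral_add_right _ measurable_const, lintegral_const_mul' _ _ (by simp),
                setLIntegral_const]
              simp only [Real.volume_Ico]
              ring
    _ = 2 * J + 2 * (ENNReal.ofReal (b - a) * ∫⁻ ω, ‖(P[A - ξ | m]) ω‖ₑ ^ 2 ∂P) := by
        rw [lintegral_add_left (hmξ.const_mul 2), lintegral_const_mul' _ _ (by simp),
          lintegral_const_mul' _ _ (by simp), lintegral_const_mul' _ _ ENNReal.ofReal_ne_top]
    _ ≤ 2 * J + 2 * (ENNReal.ofReal (b - a) *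
          ∫⁻ ω, ENNReal.ofReal (b - a)⁻¹ * ∫⁻ v in Ico a b, ‖W v ω - ξ ω‖ₑ ^ 2 ∂volume ∂P) := by
        gcongr 2 * J + 2 * (ENNReal.ofReal (b - a) * ?_)
        refine hD.trans (lintegral_mono_ae ?_)
        filter_upwards [key ξ] with ω hω
        rwa [enorm_sub_rev]
    _ = 4 * J := by
        rw [lintegral_const_mul' _ _ ENNReal.ofReal_ne_top, ← mul_assoc (ENNReal.ofReal (b - a)),
          ← ENNReal.ofReal_mul hc.le, mul_inv_cancel₀ hc.ne', ENNReal.ofReal_one, one_mul, ← hJ,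
          ← add_mul]
        norm_num

lemma prog_min {Ω : Type*} {m0 : MeasurableSpace Ω} {E : Type*} [NormedAddCommGroup E]
    {ℱ : Filtration ℝ m0} {Z : ℝ → Ω → E} (hZ : IsStronglyProgressive ℱ Z) (t : ℝ) :
    StronglyMeasurable[(inferInstance : MeasurableSpace ℝ).prod (ℱ t)]
      fun p : ℝ × Ω => Z (min p.1 t) p.2 := by
  let : MeasurableSpace Ω := ℱ t
  have h := hZ t
  exact h.comp_measurable (g := fun p : ℝ × Ω => ((⟨min p.1 t, mem_Iic.2 (min_le_right _ _)⟩ : Iic t), p.2))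
    ((Measurable.subtype_mk (by fun_prop)).prodMk measurable_snd)

lemma xi_meas {Ω : Type*} {m0 : MeasurableSpace Ω} {E : Type*} [NormedAddCommGroup E]
    [NormedSpace ℝ E] [CompleteSpace E]
    {ℱ : Filtration ℝ m0} {Z : ℝ → Ω → E} (hZ : IsStronglyProgressive ℱ Z) (T a t : ℝ) :
    StronglyMeasurable[ℱ t] fun ω => ∫ u in Icc a t, (Icc 0 T).indicator (fun s => Z s ω) u := by
  have h := prog_min hZ t
  have h2 : ∀ ω, ∫ u in Icc a t, (Icc 0 T).indicator (fun s => Z s ω) u =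
      ∫ u in Icc a t, (Icc 0 T).indicator (fun s => Z (min s t) ω) u := by
    intro ω
    refine setIntegral_congr_fun measurableSet_Icc fun u hu => ?_
    simp only [indicator, min_eq_left hu.2]
  simp only [h2]
  let : MeasurableSpace Ω := ℱ t
  refine StronglyMeasurable.integral_prod_left'
    (f := fun p : ℝ × Ω => (Icc 0 T).indicator (fun s => Z (min s t) p.2) p.1) ?_
  exact h.indicator (s := {p : ℝ × Ω | p.1 ∈ Icc 0 T}) (measurable_fst measurableSet_Icc)

lemma subst_bound {E : Type*} [NormedAddCommGroup E] (f : ℝ → E) {s r δ : ℝ}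
    (h1 : r ≤ s) (h2 : s ≤ r + δ) :
    ∫⁻ v in Icc (r - δ) r, ‖f s - f v‖ₑ ^ 2 ≤
      ∫⁻ u in Icc 0 (2 * δ), ‖f s - f (s - u)‖ₑ ^ 2 := by
  calc _ ≤ ∫⁻ v in Icc (s - 2 * δ) s, ‖f s - f v‖ₑ ^ 2 :=
        lintegral_mono_set (Icc_subset_Icc (by linarith) h1)
    _ = _ := by
      rw [← lintegral_indicator measurableSet_Icc, ← lintegral_indicator measurableSet_Icc,
        ← lintegral_sub_left_eq_self _ s]
      refine lintegral_congr fun u => ?_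
      simp only [indicator, mem_Icc]
      congr 1
      exact propext ⟨fun h => ⟨by linarith [h.2], by linarith [h.1]⟩,
        fun h => ⟨by linarith [h.2], by linarith [h.1]⟩⟩

lemma sum_Ico (G : ℝ → ℝ≥0∞) (t : ℕ → ℝ) (N : ℕ) (ht : ∀ i < N, t i < t (i + 1)) :
    t 0 ≤ t N ∧ ∑ i ∈ Finset.range N, ∫⁻ s in Ico (t i) (t (i + 1)), G s =
      ∫⁻ s in Ico (t 0) (t N), G s := by
  induction N with
  | zero => simp
  | succ n ih =>
    obtain ⟨h1, h2⟩ := ih fun i hi => ht i (by omega)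
    have h3 := ht n (by omega)
    refine ⟨h1.trans h3.le, ?_⟩
    rw [Finset.sum_range_succ, h2, ← lintegral_union measurableSet_Ico,
      Ico_union_Ico_eq_Ico h1 h3.le]
    rw [Set.disjoint_left]
    intro x hx hx'
    exact absurd hx.2 (not_lt.2 hx'.1)

lemma triple {Ω : Type*} {m0 : MeasurableSpace Ω} {P : Measure Ω} [SFinite P]
    {E : Type*} [NormedAddCommGroup E] {W : ℝ → Ω → E}
    (hW : StronglyMeasurable (Function.uncurry W)) (δ : ℝ) (t : ℕ → ℝ) (N : ℕ)
    (ht : ∀ i < N, t i < t (i + 1)) :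
    ∑ i ∈ Finset.range N, ∫⁻ ω, ∫⁻ s in Ico (t i) (t (i + 1)),
      ∫⁻ u in Icc 0 (2 * δ), ‖W s ω - W (s - u) ω‖ₑ ^ 2 ∂volume ∂volume ∂P ≤
    ∫⁻ u in Icc 0 (2 * δ), ∫⁻ ω, ∫⁻ s, ‖W s ω - W (s - u) ω‖ₑ ^ 2 ∂volume ∂P ∂volume := by
  have hF : Measurable fun p : (Ω × ℝ) × ℝ => ‖W p.1.2 p.1.1 - W (p.1.2 - p.2) p.1.1‖ₑ ^ 2 := by
    refine Measurable.pow_const (StronglyMeasurable.enorm ?_) 2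
    exact (hW.comp_measurable (g := fun p : (Ω × ℝ) × ℝ => (p.1.2, p.1.1)) (by fun_prop)).sub
      (hW.comp_measurable (g := fun p : (Ω × ℝ) × ℝ => (p.1.2 - p.2, p.1.1)) (by fun_prop))
  have hK : Measurable fun p : Ω × ℝ =>
      ∫⁻ u in Icc 0 (2 * δ), ‖W p.2 p.1 - W (p.2 - u) p.1‖ₑ ^ 2 :=
    hF.lintegral_prod_right'
  rw [← lintegral_finsetSum _ fun i _ => hK.lintegral_prod_right']
  calc _ ≤ ∫⁻ ω, ∫⁻ u in Icc 0 (2 * δ), ∫⁻ s, ‖W s ω - W (s - u) ω‖ₑ ^ 2 ∂volume ∂volume ∂P := by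
        refine lintegral_mono fun ω => ?_
        rw [(sum_Ico _ t N ht).2, lintegral_lintegral_swap]
        · refine lintegral_mono fun u => ?_
          exact setLIntegral_le_lintegral _ _
        · exact (hF.comp (g := _) (f := fun q : ℝ × ℝ => ((ω, q.1), q.2))
            (by fun_prop)).aemeasurable
    _ = _ := by
        rw [lintegral_lintegral_swap]
        refine Measurable.aemeasurable ?_
        refine Measurable.lintegral_prod_right'
          (f := fun q : (Ω × ℝ) × ℝ => ‖W q.2 q.1.1 - W (q.2 - q.1.2) q.1.1‖ₑ ^ 2) ?_
        exact hF.comp (f := fun q : (Ω × ℝ) × ℝ => ((q.1.1, q.2), q.1.2)) (by fun_prop)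

/-- Let `Z` be a progressively measurable, square-integrable
`ℝ^d`-valued process on `[0,T]`.  For a partition `π = {0 = t₀ < ⋯ < t_N = T}` define the
piecewise constant process `Z̄^π` by the conditional time averages
`Z̄ᵢ = (t_{i+1} - t_i)⁻¹ E[∫_{t_i}^{t_{i+1}} Z_s ds | F_{t_i}]` on `[t_i, t_{i+1})`.
Then `E[∫₀^T |Z_s - Z̄^π_s|² ds] → 0` as the mesh `|π| → 0`. -/
theorem stmt_5
    {Ω : Type*} {m0 : MeasurableSpace Ω} {P : Measure Ω} [IsProbabilityMeasure P]
    (T : ℝ) (hT : 0 < T) (d : ℕ)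
    (ℱ : Filtration ℝ m0)
    (Z : ℝ → Ω → EuclideanSpace ℝ (Fin d))
    (hZprog : ProgMeasurable ℱ Z)
    (hZint : ∫⁻ ω, ∫⁻ s in Icc (0:ℝ) T, (‖Z s ω‖₊ : ℝ≥0∞) ^ 2 ∂volume ∂P < ⊤) :
    ∀ ε > (0:ℝ), ∃ δ > (0:ℝ), ∀ (N : ℕ) (t : ℕ → ℝ),
      0 < N → t 0 = 0 → t N = T →
      (∀ i < N, t i < t (i + 1)) →
      (∀ i < N, t (i + 1) - t i ≤ δ) →
      ∑ i ∈ Finset.range N,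
          ∫⁻ ω, ∫⁻ s in Ico (t i) (t (i + 1)),
            (‖Z s ω - (t (i + 1) - t i)⁻¹ •
              (P[(fun ω' => ∫ u in Icc (t i) (t (i + 1)), Z u ω') | ℱ (t i)]) ω‖₊ : ℝ≥0∞) ^ 2
            ∂volume ∂P
        < ENNReal.ofReal ε := by
  intro ε hε
  set W : ℝ → Ω → EuclideanSpace ℝ (Fin d) :=
    fun s ω => (Icc 0 T).indicator (fun s => Z s ω) s with hWdef
  have hWZ : ∀ s ∈ Icc 0 T, ∀ ω, W s ω = Z s ω := fun s hs ω => by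
    simp only [hWdef, indicator_of_mem hs]
  have hW : StronglyMeasurable (Function.uncurry W) := by
    have h := (prog_min hZprog T).mono (m := (inferInstance : MeasurableSpace ℝ).prod m0)
      (sup_le_sup le_rfl (MeasurableSpace.comap_mono (ℱ.le T)))
    have h2 := h.indicator (s := {p : ℝ × Ω | p.1 ∈ Icc 0 T}) (measurable_fst measurableSet_Icc)
    refine Eq.subst (motive := fun g => StronglyMeasurable g) (funext fun p => ?_) h2
    symm
    by_cases hp : p.1 ∈ Icc 0 T
    · rw [indicator_of_mem (by exact hp), min_eq_left hp.2]
      exact hWZ _ hp _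
    · rw [indicator_of_notMem (by exact hp)]
      simp only [Function.uncurry, hWdef, indicator_of_notMem hp]
  have hW2 : ∫⁻ ω, ∫⁻ s, ‖W s ω‖ₑ ^ 2 ∂volume ∂P < ⊤ := by
    convert hZint using 3 with ω
    rw [← lintegral_indicator measurableSet_Icc]
    refine lintegral_congr fun s => ?_
    by_cases hs : s ∈ Icc 0 T
    · rw [indicator_of_mem hs, hWZ s hs]; rfl
    · rw [indicator_of_notMem hs]; simp [hWdef, indicator_of_notMem hs]
  have hlim := transl_avg hW hW2
  have hη : (0 : ℝ≥0∞) < ENNReal.ofReal (ε / 16) := ENNReal.ofReal_pos.2 (by positivity)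
  obtain ⟨ρ, hρ, hball⟩ := Metric.eventually_nhds_iff.1 (hlim.eventually (gt_mem_nhds hη))
  refine ⟨ρ / 4, by positivity, ?_⟩
  set δ := ρ / 4 with hδ
  have hδ0 : 0 < δ := by positivity
  intro N t hN h0 hT' hlt hmesh
  have hmono : ∀ k i, i + k ≤ N → t i ≤ t (i + k) := by
    intro k
    induction k with
    | zero => intro i _; exact le_rfl
    | succ k ih => intro i hi; exact (ih i (by omega)).trans (hlt (i + k) (by omega)).le
  have hpos : ∀ i ≤ N, 0 ≤ t i := fun i hi => by
    have := hmono i 0 (by omega); rwa [zero_add, h0] at this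
  have hleT : ∀ i ≤ N, t i ≤ T := fun i hi => by
    have := hmono (N - i) i (by omega); rwa [Nat.add_sub_cancel' hi, hT'] at this
  have hterm : ∀ i ∈ Finset.range N,
      ∫⁻ ω, ∫⁻ s in Ico (t i) (t (i + 1)),
            (‖Z s ω - (t (i + 1) - t i)⁻¹ •
              (P[(fun ω' => ∫ u in Icc (t i) (t (i + 1)), Z u ω') | ℱ (t i)]) ω‖₊ : ℝ≥0∞) ^ 2
            ∂volume ∂P ≤
      4 * (ENNReal.ofReal δ⁻¹ * ∫⁻ ω, ∫⁻ s in Ico (t i) (t (i + 1)),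
        ∫⁻ u in Icc 0 (2 * δ), ‖W s ω - W (s - u) ω‖ₑ ^ 2 ∂volume ∂volume ∂P) := by
    intro i hi
    have hi' : i < N := Finset.mem_range.1 hi
    have hsub : ∀ s ∈ Icc (t i) (t (i + 1)), s ∈ Icc 0 T := fun s hs =>
      ⟨(hpos i hi'.le).trans hs.1, hs.2.trans (hleT (i + 1) hi')⟩
    have hI : (fun ω' => ∫ u in Icc (t i) (t (i + 1)), Z u ω') =
        fun ω' => ∫ u in Icc (t i) (t (i + 1)), W u ω' := by
      ext1 ω
      exact setIntegral_congr_fun measurableSet_Icc fun u hu => (hWZ u (hsub u hu) ω).symm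
    have hab : t i - δ < t i := by linarith
    have hξm : StronglyMeasurable[ℱ (t i)] fun ω =>
        (t i - (t i - δ))⁻¹ • ∫ u in Icc (t i - δ) (t i), W u ω :=
      (xi_meas hZprog T (t i - δ) (t i)).fun_const_smul _
    have happ := approx (ℱ.le (t i)) hW hW2 (hlt i hi') hξm (avg_memLp hW hW2 hab)
    calc _ = ∫⁻ ω, ∫⁻ s in Ico (t i) (t (i + 1)), ‖W s ω - (t (i + 1) - t i)⁻¹ •
              (P[(fun ω' => ∫ u in Icc (t i) (t (i + 1)), W u ω') | ℱ (t i)]) ω‖ₑ ^ 2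
            ∂volume ∂P := by
          rw [hI]
          refine lintegral_congr fun ω => setLIntegral_congr_fun measurableSet_Ico fun s hs => ?_
          simp only [hWZ s (hsub s (Ico_subset_Icc_self hs)) ω]
          rfl
      _ ≤ _ := happ
      _ ≤ _ := by
          gcongr
          rw [← lintegral_const_mul' _ _ ENNReal.ofReal_ne_top]
          refine lintegral_mono_ae ?_
          filter_upwards [avg_key hW hW2 hab] with ω hω
          rw [← lintegral_const_mul' _ _ ENNReal.ofReal_ne_top]
          refine setLIntegral_mono' measurableSet_Ico fun s hs => ?_
          refine (hω (W s ω)).trans ?_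
          rw [sub_sub_cancel]
          refine mul_le_mul_right ?_ _
          exact subst_bound (δ := δ) (fun s => W s ω) hs.1 (by linarith [hs.2, hmesh i hi'])
  calc _ ≤ ∑ i ∈ Finset.range N, 4 * (ENNReal.ofReal δ⁻¹ *
        ∫⁻ ω, ∫⁻ s in Ico (t i) (t (i + 1)),
        ∫⁻ u in Icc 0 (2 * δ), ‖W s ω - W (s - u) ω‖ₑ ^ 2 ∂volume ∂volume ∂P) :=
        Finset.sum_le_sum hterm
    _ ≤ 4 * (ENNReal.ofReal δ⁻¹ * ∫⁻ u in Icc 0 (2 * δ), ∫⁻ ω, ∫⁻ s,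
          ‖W s ω - W (s - u) ω‖ₑ ^ 2 ∂volume ∂P ∂volume) := by
        rw [← Finset.mul_sum, ← Finset.mul_sum]
        gcongr
        exact triple hW δ t N hlt
    _ ≤ 4 * (ENNReal.ofReal δ⁻¹ * ∫⁻ u in Icc 0 (2 * δ), ENNReal.ofReal (ε / 16)) := by
        gcongr 4 * (ENNReal.ofReal δ⁻¹ * ?_)
        refine setLIntegral_mono' measurableSet_Icc fun u hu => ?_
        refine (hball ?_).le
        rw [Real.dist_eq, sub_zero, abs_of_nonneg hu.1]
        linarith [hu.2]
    _ = ENNReal.ofReal (ε / 2) := by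
        rw [setLIntegral_const, Real.volume_Icc, ← ENNReal.ofReal_mul (by positivity),
          ← ENNReal.ofReal_mul (by positivity), ← ENNReal.ofReal_ofNat 4,
          ← ENNReal.ofReal_mul (by norm_num)]
        congr 1
        field_simp
        ring
    _ < ENNReal.ofReal ε := (ENNReal.ofReal_lt_ofReal_iff hε).2 (by linarith)
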